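/- Let t_0 > 0, let K_0, K_1 : [0,t_0] → ℝ be continuous with K_1(t) ≤ K_0(t) for all t ∈ [0,t_0], and let w_0, w_1 ∈ ℝ with w_1 ≥ w_0. Suppose r_0 : [0,t_0] → ℝ is a solution of the Riccati equation ṙ_0 + r_0² + K_0(t) = 0 with r_0(0) = w_0 defined on all of [0,t_0], and r_1 is the solution of ṙ_1 + r_1² + K_1(t) = 0 with r_1(0) = w_1. Then r_1 is defined on all of [0,t_0] and r_1(t) ≥ r_0(t) for every t ∈ [0,t_0]. -/

import Mathlib

/-- A one-sided comparison principle: if `f - g` grows at most exponentially wherever it is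
positive, and is nonpositive at `0`, then it stays nonpositive. -/
theorem le_of_hasDerivWithinAt_of_sub_le_mul {T L : ℝ} {f g f' g' : ℝ → ℝ} (h0 : f 0 ≤ g 0)
    (hf : ∀ t ∈ Set.Icc 0 T, HasDerivWithinAt f (f' t) (Set.Icc 0 T) t)
    (hg : ∀ t ∈ Set.Icc 0 T, HasDerivWithinAt g (g' t) (Set.Icc 0 T) t)
    (h : ∀ t ∈ Set.Icc 0 T, g t < f t → f' t - g' t ≤ L * (f t - g t)) :
    ∀ t ∈ Set.Icc 0 T, f t ≤ g t := by
  intro t ht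
  have key : ∀ ε > 0, f t - g t ≤ ε * Real.exp ((L + 1) * t) := by
    intro ε hε
    have hB : ∀ x, HasDerivAt (fun s => ε * Real.exp ((L + 1) * s))
        ((L + 1) * (ε * Real.exp ((L + 1) * x))) x := by
      intro x
      refine ((((hasDerivAt_id' x).const_mul (L + 1)).exp).const_mul ε).congr_deriv ?_
      ring
    refine image_le_of_deriv_right_lt_deriv_boundary' (f := fun s => f s - g s)
      (f' := fun s => f' s - g' s) (a := 0) (b := T)
      (B' := fun x => (L + 1) * (ε * Real.exp ((L + 1) * x)))
      (fun x hx => ((hf x hx).sub (hg x hx)).continuousWithinAt) ?_ ?_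
      (fun x _ => (hB x).continuousAt.continuousWithinAt)
      (fun x _ => (hB x).hasDerivWithinAt) ?_ ht
    · intro x hx
      have hx' := Set.Ico_subset_Icc_self hx
      exact ((hf x hx').sub (hg x hx')).mono_of_mem_nhdsWithin (Icc_mem_nhdsGE_of_mem hx)
    · simp only [mul_zero, Real.exp_zero, mul_one]
      linarith
    · intro x hx hxe
      have hpos : 0 < ε * Real.exp ((L + 1) * x) := by positivity
      have := h x (Set.Ico_subset_Icc_self hx) (by linarith)
      rw [hxe] at this
      linarith
  refine le_of_forall_pos_le_add fun δ hδ => ?_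
  have := key (δ / Real.exp ((L + 1) * t)) (by positivity)
  rw [div_mul_cancel₀ _ (Real.exp_pos _).ne'] at this
  linarith

/-- A bounded vector field that is Lipschitz in space and continuous in time has solutions on
the whole time interval. -/
theorem exists_forall_hasDerivWithinAt_of_bounded {T : ℝ} (hT : 0 ≤ T) {v : ℝ → ℝ → ℝ}
    {C L : NNReal} (hlip : ∀ t ∈ Set.Icc 0 T, LipschitzWith L (v t))
    (hcont : ∀ x, ContinuousOn (fun t => v t x) (Set.Icc 0 T))
    (hbound : ∀ t ∈ Set.Icc 0 T, ∀ x, |v t x| ≤ C) (x₀ : ℝ) :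
    ∃ r : ℝ → ℝ, r 0 = x₀ ∧
      ∀ t ∈ Set.Icc 0 T, HasDerivWithinAt r (v t (r t)) (Set.Icc 0 T) t := by
  have hpl : IsPicardLindelof v (⟨0, le_rfl, hT⟩ : Set.Icc 0 T) x₀ (C * T.toNNReal) 0 C L :=
    { lipschitzOnWith := fun t ht => (hlip t ht).lipschitzOnWith
      continuousOn := fun x _ => hcont x
      norm_le := fun t ht x _ => hbound t ht x
      mul_max_le := by simp [hT] }
  exact hpl.exists_eq_forall_mem_Icc_hasDerivWithinAt₀


/-- **Lemma 7.5 (Riccati comparison).**  Let `t₀ > 0`, let `K₀, K₁` be continuous on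
`[0,t₀]` with `K₁ ≤ K₀` there, and let `w₁ ≥ w₀`.  If `r₀` solves
`ṙ₀ + r₀² + K₀(t) = 0`, `r₀(0) = w₀` on all of `[0,t₀]`, then the solution `r₁` of
`ṙ₁ + r₁² + K₁(t) = 0`, `r₁(0) = w₁` is defined on all of `[0,t₀]` and satisfies
`r₁(t) ≥ r₀(t)` there.  (Solutions of a Riccati equation are unique, so the `r₁`
produced below is the solution with `r₁(0) = w₁`.) -/
theorem riccati_comparison
    (t₀ : ℝ) (ht₀ : 0 < t₀)
    (K₀ K₁ : ℝ → ℝ)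
    (hK₀ : ContinuousOn K₀ (Set.Icc 0 t₀))
    (hK₁ : ContinuousOn K₁ (Set.Icc 0 t₀))
    (hK : ∀ t ∈ Set.Icc (0 : ℝ) t₀, K₁ t ≤ K₀ t)
    (w₀ w₁ : ℝ) (hw : w₀ ≤ w₁)
    (r₀ : ℝ → ℝ)
    (hr₀ : ∀ t ∈ Set.Icc (0 : ℝ) t₀,
      HasDerivWithinAt r₀ (-(r₀ t) ^ 2 - K₀ t) (Set.Icc 0 t₀) t)
    (hr₀0 : r₀ 0 = w₀) :
    ∃ r₁ : ℝ → ℝ, r₁ 0 = w₁ ∧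
      (∀ t ∈ Set.Icc (0 : ℝ) t₀,
        HasDerivWithinAt r₁ (-(r₁ t) ^ 2 - K₁ t) (Set.Icc 0 t₀) t) ∧
      ∀ t ∈ Set.Icc (0 : ℝ) t₀, r₀ t ≤ r₁ t := by
  obtain ⟨A, hA⟩ := isCompact_Icc.exists_bound_of_continuousOn
    (fun t ht => (hr₀ t ht).continuousWithinAt)
  obtain ⟨M, hM⟩ := isCompact_Icc.exists_bound_of_continuousOn hK₁
  simp only [Real.norm_eq_abs] at hA hM
  have h0mem : (0 : ℝ) ∈ Set.Icc 0 t₀ := ⟨le_rfl, ht₀.le⟩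
  have hM0 : 0 ≤ M := (abs_nonneg _).trans (hM 0 h0mem)
  set R : ℝ := max A (w₁ + M * t₀)
  have hR0 : 0 ≤ R := ((abs_nonneg _).trans (hA 0 h0mem)).trans (le_max_left _ _)
  set c : ℝ → ℝ := fun x => max (min x R) (-R) with hc
  have hc_abs : ∀ x, |c x| ≤ R := fun x =>
    abs_le.2 ⟨le_max_right _ _, max_le (min_le_right _ _) (by linarith)⟩
  have hc_sub : ∀ x y, |c x - c y| ≤ |x - y| := by
    intro x y
    refine (abs_max_sub_max_le_abs _ _ _).trans ((abs_min_sub_min_le_max x R y R).trans ?_)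
    simp
  have hc_id : ∀ x, |x| ≤ R → c x = x := by
    intro x hx
    simp only [hc]
    rw [min_eq_left (abs_le.1 hx).2, max_eq_left (abs_le.1 hx).1]
  have hc_sq : ∀ x y, |c x ^ 2 - c y ^ 2| ≤ 2 * R * |x - y| := by
    intro x y
    rw [sq_sub_sq, abs_mul]
    refine mul_le_mul ((abs_add_le _ _).trans ?_) (hc_sub x y) (abs_nonneg _) (by linarith)
    linarith [hc_abs x, hc_abs y]
  obtain ⟨r₁, hr₁0, hr₁⟩ := exists_forall_hasDerivWithinAt_of_bounded ht₀.le
    (v := fun t x => -c x ^ 2 - K₁ t) (C := ⟨R ^ 2 + M, by positivity⟩)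
    (L := ⟨2 * R, by positivity⟩)
    (fun t _ => LipschitzWith.of_dist_le_mul fun x y => by
      have := hc_sq x y
      rw [Real.dist_eq, Real.dist_eq, ← abs_neg]
      convert this using 2
      · ring
      · rfl)
    (fun x => continuousOn_const.sub hK₁)
    (fun t ht x => by
      have h1 := hM t ht
      have h2 : c x ^ 2 ≤ R ^ 2 := sq_le_sq' (abs_le.1 (hc_abs x)).1 (abs_le.1 (hc_abs x)).2
      have h3 := sq_nonneg (c x)
      change _ ≤ R ^ 2 + M
      rw [abs_le] at h1 ⊢
      constructor <;> nlinarith [sq_nonneg R])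
    w₁
  have hle : ∀ t ∈ Set.Icc 0 t₀, r₀ t ≤ r₁ t := by
    refine le_of_hasDerivWithinAt_of_sub_le_mul (L := 2 * R) (by linarith) hr₀ hr₁ ?_
    intro t ht hlt
    have h1 := (le_abs_self _).trans (hc_sq (r₁ t) (r₀ t))
    rw [abs_sub_comm, abs_of_pos (sub_pos.2 hlt),
      hc_id (r₀ t) ((hA t ht).trans (le_max_left _ _))] at h1
    linarith [hK t ht]
  have hupper : ∀ t ∈ Set.Icc 0 t₀, r₁ t ≤ w₁ + M * t := by
    refine le_of_hasDerivWithinAt_of_sub_le_mul (L := 0) (g' := fun _ => M) (by simp [hr₁0]) hr₁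
      (fun t _ => ?_) ?_
    · simpa using (((hasDerivAt_id t).const_mul M).const_add w₁).hasDerivWithinAt
    · intro t ht _
      nlinarith [sq_nonneg (c (r₁ t)), (abs_le.1 (hM t ht)).1]
  refine ⟨r₁, hr₁0, fun t ht => ?_, hle⟩
  have h : |r₁ t| ≤ R := by
    refine abs_le.2 ⟨?_, ?_⟩
    · linarith [hle t ht, (abs_le.1 (hA t ht)).1, le_max_left A (w₁ + M * t₀)]
    · have := mul_le_mul_of_nonneg_left ht.2 hM0
      linarith [hupper t ht, le_max_right A (w₁ + M * t₀)]
  simpa only [hc_id _ h] using hr₁ t ht
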